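/- The graph J*_I has a proper 4-colouring if and only if the graph J_I^4 has a proper 4-colouring that extends the precolouring c_{W^4}. -/

import Mathlib

open SimpleGraph

/-- An instance of Not-All-Equal 3-Satisfiability with positive literals:
variables are indexed by `Fin n`, and each of the `m` clauses is an ordered
triple of variables. -/
structure NAE (n m : ℕ) where
  clause : Fin m → Fin 3 → Fin n

/-- A truth assignment in which each clause contains at least one true and at
least one false variable. -/
def NAE.Satisfiable {n m : ℕ} (I : NAE n m) : Prop :=
  ∃ τ : Fin n → Bool, ∀ j : Fin m,
    (∃ h : Fin 3, τ (I.clause j h) = true) ∧ (∃ h : Fin 3, τ (I.clause j h) = false)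

/-- Vertices of the graph `J_I`: `a`- and `b`-type vertices of the two clause
components (`p = false` for the unprimed component, `p = true` for the primed
one), and one `x`-type vertex per variable.  The `a`-vertices of a component are
`a j p 0, a j p 1, a j p 2` and its `b`-vertices `b j p 0, b j p 1`; the
component is the induced path `a j p 0 - b j p 0 - a j p 1 - b j p 1 - a j p 2`. -/
inductive JV (n m : ℕ) where
  | a (j : Fin m) (p : Bool) (h : Fin 3)
  | b (j : Fin m) (p : Bool) (h : Fin 2)
  | x (i : Fin n)

/-- Base relation for the edges of `J_I`. -/
def JRel {n m : ℕ} (I : NAE n m) : JV n m → JV n m → Prop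
  | .a j p h, .b j' p' h' => j = j' ∧ p = p' ∧ (h = h'.castSucc ∨ h = h'.succ)
  | .a j _ h, .x i => I.clause j h = i
  | .x _, .b _ _ _ => True
  | _, _ => False

/-- The graph `J_I`. -/
def JGraph {n m : ℕ} (I : NAE n m) : SimpleGraph (JV n m) := fromRel (JRel I)

/-- The 4-list assignment `L` of `J_I`. -/
def Lassign {n m : ℕ} : JV n m → Finset ℕ
  | .a _ p h =>
      if p then (if h.val = 0 then {1,4} else if h.val = 1 then {1,3,4} else {1,3})
      else (if h.val = 0 then {2,4} else if h.val = 1 then {2,3,4} else {2,3})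
  | .b _ _ _ => {3,4}
  | .x _ => {1,2}

/-- Vertices of the graph `J_I'`: those of `J_I` together with the `c`-type
subdivision vertices, one for each edge between an `a`-type and an `x`-type
vertex (i.e., one for each `a`-type vertex `a j p h`, subdividing its edge to
the vertex of the variable `clause j h`). -/
inductive JV' (n m : ℕ) where
  | a (j : Fin m) (p : Bool) (h : Fin 3)
  | b (j : Fin m) (p : Bool) (h : Fin 2)
  | x (i : Fin n)
  | c (j : Fin m) (p : Bool) (h : Fin 3)

/-- Base relation for the edges of `J_I'`. -/
def J'Rel {n m : ℕ} (I : NAE n m) : JV' n m → JV' n m → Prop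
  | .a j p h, .b j' p' h' => j = j' ∧ p = p' ∧ (h = h'.castSucc ∨ h = h'.succ)
  | .c j p h, .a j' p' h' => j = j' ∧ p = p' ∧ h = h'
  | .c j _ h, .x i => I.clause j h = i
  | .x _, .b _ _ _ => True
  | _, _ => False

/-- The graph `J_I'`. -/
def J'Graph {n m : ℕ} (I : NAE n m) : SimpleGraph (JV' n m) := fromRel (J'Rel I)

/-- The 4-list assignment `L'` of `J_I'`. -/
def L'assign {n m : ℕ} : JV' n m → Finset ℕ
  | .a _ p h =>
      if p then (if h.val = 0 then {1,4} else if h.val = 1 then {1,3,4} else {1,3})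
      else (if h.val = 0 then {2,4} else if h.val = 1 then {2,3,4} else {2,3})
  | .b _ _ _ => {3,4}
  | .x _ => {1,2}
  | .c _ _ _ => {1,2}

/-- `a`-type or `x`-type vertices of `J_I'`. -/
def JV'.isAX {n m : ℕ} : JV' n m → Bool
  | .a _ _ _ => true
  | .x _ => true
  | _ => false

/-- `b`-type vertices of `J_I'`. -/
def JV'.isB {n m : ℕ} : JV' n m → Bool
  | .b _ _ _ => true
  | _ => false

/-- `c`-type vertices of `J_I'`. -/
def JV'.isC {n m : ℕ} : JV' n m → Bool
  | .c _ _ _ => true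
  | _ => false

/-- Vertices of the graph `J_I^k`: the vertices of `J_I'` together with, for
each vertex `v` of `J_I'`, exactly `k - |L'(v)|` pendant vertices. -/
inductive JVK (n m k : ℕ) where
  | orig (v : JV' n m)
  | pend (v : JV' n m) (i : Fin (k - (L'assign v).card))

/-- Base relation for the edges of `J_I^k`. -/
def JKRel {n m k : ℕ} (I : NAE n m) : JVK n m k → JVK n m k → Prop
  | .orig u, .orig v => J'Rel I u v
  | .pend v _, .orig u => u = v
  | _, _ => False

/-- The graph `J_I^k`. -/
def JKGraph {n m : ℕ} (I : NAE n m) (k : ℕ) : SimpleGraph (JVK n m k) :=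
  fromRel (JKRel I)

/-- A graph is chordal bipartite if it is bipartite (2-colourable) and has no
induced cycle on any number of vertices other than four. -/
def ChordalBipartite {V : Type*} (G : SimpleGraph V) : Prop :=
  G.Colorable 2 ∧ ∀ s : ℕ, 3 ≤ s → s ≠ 4 → IsEmpty (cycleGraph s ↪g G)

/-- The disjoint union `P_1 + 2P_2` on five vertices: vertex `0` is isolated
and `1-2`, `3-4` are the two `P_2`s. -/
def P1plus2P2 : SimpleGraph (Fin 5) :=
  fromRel (fun u v => (u = 1 ∧ v = 2) ∨ (u = 3 ∧ v = 4))

/-- The disjoint union `P_1 + P_4` on five vertices: vertex `0` is isolated and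
`1-2-3-4` is the `P_4`. -/
def P1plusP4 : SimpleGraph (Fin 5) :=
  fromRel (fun u v => (u = 1 ∧ v = 2) ∨ (u = 2 ∧ v = 3) ∨ (u = 3 ∧ v = 4))

/-- The vertex of `Fin 23` carrying label `i ∈ {1, …, 23}`. -/
def vtx (i : ℕ) : Fin 23 := ⟨(i - 1) % 23, by omega⟩

/-- The edges (by labels in `{1, …, 23}`) of the graph `M'`, i.e. of the
Mycielski graph `M_5` minus the edge `{17, 23}`. -/
def MpEdges : List (ℕ × ℕ) :=
  [(1,2),(2,3),(3,5),(5,4),(4,1),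
   (6,2),(6,4),(7,1),(7,3),(8,2),(8,5),(9,1),(9,5),(10,3),(10,4),
   (11,6),(11,7),(11,8),(11,9),(11,10),
   (12,2),(12,4),(12,7),(12,9),(13,1),(13,3),(13,6),(13,8),
   (14,2),(14,5),(14,7),(14,10),(15,1),(15,5),(15,6),(15,10),
   (16,3),(16,4),(16,8),(16,9),
   (17,2),(17,4),(17,11),(18,1),(18,3),(18,11),(19,2),(19,5),(19,11),
   (20,1),(20,5),(20,11),(21,3),(21,4),(21,11),
   (22,6),(22,7),(22,8),(22,9),(22,10),
   (12,23),(13,23),(14,23),(15,23),(16,23),(18,23),(19,23),(20,23),(21,23),(22,23)]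

/-- The edges (by labels) of the Mycielski graph `M_5`. -/
def M5Edges : List (ℕ × ℕ) := (17,23) :: MpEdges

/-- The Mycielski graph `M_5` on 23 vertices. -/
def M5 : SimpleGraph (Fin 23) :=
  fromRel (fun u v => ∃ e ∈ M5Edges, u = vtx e.1 ∧ v = vtx e.2)

/-- The graph `M'`, i.e. `M_5` minus the edge `{17, 23}`. -/
def Mp : SimpleGraph (Fin 23) :=
  fromRel (fun u v => ∃ e ∈ MpEdges, u = vtx e.1 ∧ v = vtx e.2)

/-- The vertex set `T = {2, 4, 11, 23}` of `M'`. -/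
def Tset : Set (Fin 23) := {vtx 2, vtx 4, vtx 11, vtx 23}

/-- The list of colours `{1,2,3,4} \ L'(v)`, used to precolour the pendant
vertices attached to `v` in `J_I^4`. -/
def complList {n m : ℕ} : JV' n m → List ℕ
  | .a _ p h =>
      if p then (if h.val = 0 then [2,3] else if h.val = 1 then [2] else [2,4])
      else (if h.val = 0 then [1,3] else if h.val = 1 then [1] else [1,4])
  | .b _ _ _ => [1,2]
  | .x _ => [3,4]
  | .c _ _ _ => [3,4]

/-- The precolouring `c_{W^4}` of the pendant vertices of `J_I^4`: the pendant
vertices attached to `v` receive the distinct colours of `{1,2,3,4} \ L'(v)`. -/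
def cW4 {n m : ℕ} (v : JV' n m) (i : Fin (4 - (L'assign v).card)) : ℕ :=
  (complList v).getD i.val 0

/-- The vertex `t_j` of (the copy of) `M'`, for `j ∈ {1,2,3,4}`:
`t_1 = 2`, `t_2 = 4`, `t_3 = 11`, `t_4 = 23`. -/
def tvert (j : ℕ) : Fin 23 :=
  if j = 1 then vtx 2 else if j = 2 then vtx 4 else if j = 3 then vtx 11 else vtx 23

/-- Vertices of the graph `J*_I`: the vertices of `J_I'`, the pendant vertices
of `J_I^4` attached to `a`- or `x`-type vertices (the vertices pendant to
`B ∪ C` having been removed), and a copy of `M'`. -/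
inductive JStarV (n m : ℕ) where
  | orig (v : JV' n m)
  | pend (v : JV' n m) (i : Fin (4 - (L'assign v).card)) (hv : v.isAX = true)
  | mv (t : Fin 23)

/-- Base relation for the edges of `J*_I`. -/
def JStarRel {n m : ℕ} (I : NAE n m) : JStarV n m → JStarV n m → Prop
  | .orig u, .orig v => J'Rel I u v
  | .pend v _ _, .orig u => u = v
  | .pend v i _, .mv t => ∃ j ∈ ({1,2,3,4} : Finset ℕ), j ≠ cW4 v i ∧ t = tvert j
  | .orig u, .mv t =>
      (u.isB = true ∧ (t = vtx 2 ∨ t = vtx 4)) ∨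
      (u.isC = true ∧ (t = vtx 11 ∨ t = vtx 23))
  | .mv s, .mv t => ∃ e ∈ MpEdges, s = vtx e.1 ∧ t = vtx e.2
  | _, _ => False

/-- The graph `J*_I`. -/
def JStar {n m : ℕ} (I : NAE n m) : SimpleGraph (JStarV n m) := fromRel (JStarRel I)

/-- `b`-type vertices of `J_I^k`. -/
def JVK.isB {n m k : ℕ} : JVK n m k → Bool
  | .orig v => v.isB
  | _ => false

/-- A pendant vertex of `J_I^4 - B`: a vertex with exactly one neighbour among
the non-`b`-type vertices. -/
def PendantOutsideB {n m : ℕ} (I : NAE n m) (v : JVK n m 4) : Prop :=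
  ∃! w : JVK n m 4, w.isB = false ∧ (JKGraph I 4).Adj v w


/-- To check that `c` is a proper colouring of `fromRel r` it is enough to look at each
related pair in one order. -/
theorem fromRel_ne_of_rel {V α : Type*} {r : V → V → Prop} {c : V → α}
    (h : ∀ u v, u ≠ v → r u v → c u ≠ c v) (u v : V) (huv : (fromRel r).Adj u v) :
    c u ≠ c v := by
  rw [fromRel_adj] at huv
  obtain ⟨hne, hr | hr⟩ := huv
  · exact h u v hne hr
  · exact (h v u hne.symm hr).symm

/-- The recolouring step for Mycielski graphs: `c` colours the old vertices, `c' v` is the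
colour of the copy of `v` and `w` the colour of the apex. -/
def mycielskiRecolour {V α : Type*} [DecidableEq α] (c c' : V → α) (w : α) (v : V) : α :=
  if c v = w then c' v else c v

theorem mycielskiRecolour_ne {V α : Type*} [DecidableEq α] {c c' : V → α} (w : α) {u v : V}
    (h : c u ≠ c v) (huv : c u ≠ c' v) (hvu : c' u ≠ c v) :
    mycielskiRecolour c c' w u ≠ mycielskiRecolour c c' w v := by
  unfold mycielskiRecolour
  grind

theorem mycielskiRecolour_ne_apex {V α : Type*} [DecidableEq α] {c c' : V → α} {w : α} {v : V}
    (h : c' v ≠ w) : mycielskiRecolour c c' w v ≠ w := by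
  unfold mycielskiRecolour
  grind

theorem mycielskiRecolour_mem {V α : Type*} [DecidableEq α] {c c' : V → α} {w : α} {v : V}
    {s : Finset α} (h : c v ∈ s) (h' : c' v ∈ s) : mycielskiRecolour c c' w v ∈ s := by
  unfold mycielskiRecolour
  split_ifs <;> assumption

/-- Adjacency of labels in `M_5`. -/
def M5Adj (u v : ℕ) : Prop := (u, v) ∈ M5Edges ∨ (v, u) ∈ M5Edges

instance : DecidableRel M5Adj := fun u v => by unfold M5Adj; infer_instance

/-- The Mycielski graph `M_5` is not 4-colourable. -/
theorem not_proper_M5 (c : ℕ → ℕ) (hc : ∀ i, c i ∈ Finset.Icc 1 4) :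
    ¬ ∀ e ∈ M5Edges, c e.1 ≠ c e.2 := by
  intro h
  have hadj : ∀ {u v}, M5Adj u v → c u ≠ c v := by
    rintro u v (huv | huv)
    · exact h _ huv
    · exact (h _ huv).symm
  set d := mycielskiRecolour c (fun i => c (i + 11)) (c 23) with hd
  have hdne : ∀ u v, M5Adj u v ∧ M5Adj u (v + 11) ∧ M5Adj (u + 11) v → d u ≠ d v :=
    fun u v ⟨h₁, h₂, h₃⟩ => mycielskiRecolour_ne _ (hadj h₁) (hadj h₂) (hadj h₃)
  have hdw : ∀ u, M5Adj (u + 11) 23 → d u ≠ c 23 :=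
    fun u hu => mycielskiRecolour_ne_apex (hadj hu)
  have hdmem : ∀ u, d u ∈ Finset.Icc 1 4 := fun u => mycielskiRecolour_mem (hc _) (hc _)
  set g := mycielskiRecolour d (fun i => d (i + 5)) (d 11) with hg
  have hgne : ∀ u v,
      (M5Adj u v ∧ M5Adj u (v + 11) ∧ M5Adj (u + 11) v) ∧
      (M5Adj u (v + 5) ∧ M5Adj u (v + 5 + 11) ∧ M5Adj (u + 11) (v + 5)) ∧
      (M5Adj (u + 5) v ∧ M5Adj (u + 5) (v + 11) ∧ M5Adj (u + 5 + 11) v) → g u ≠ g v :=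
    fun u v ⟨h₁, h₂, h₃⟩ =>
      mycielskiRecolour_ne _ (hdne _ _ h₁) (hdne _ _ h₂) (hdne _ _ h₃)
  have hgw : ∀ u ∈ Finset.Icc 1 5, g u ≠ d 11 := fun u hu =>
    mycielskiRecolour_ne_apex (hdne (u + 5) 11 (by revert u; decide))
  have hgz : ∀ u ∈ Finset.Icc 1 5, g u ≠ c 23 := by
    intro u hu
    have hapex : ∀ u ∈ Finset.Icc 1 5, M5Adj (u + 11) 23 ∧ M5Adj (u + 5 + 11) 23 := by decide
    have h₁ : d u ≠ c 23 := hdw _ (hapex u hu).1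
    have h₂ : d (u + 5) ≠ c 23 := hdw _ (hapex u hu).2
    simp only [hg, mycielskiRecolour]
    split_ifs <;> assumption
  have hgmem : ∀ u, g u ∈ Finset.Icc 1 4 := fun u => mycielskiRecolour_mem (hdmem _) (hdmem _)
  have hwz : d 11 ≠ c 23 := hdw _ (by decide)
  -- only two colours remain on the 5-cycle, so they alternate along paths
  have hpath : ∀ u ∈ Finset.Icc 1 5, ∀ v ∈ Finset.Icc 1 5, ∀ x ∈ Finset.Icc 1 5,
      g u ≠ g v → g v ≠ g x → g u = g x := by
    intro u hu v hv x hx huv hvx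
    have hw := hdmem 11
    have hz := hc 23
    have := hgw u hu
    have := hgw v hv
    have := hgw x hx
    have := hgz u hu
    have := hgz v hv
    have := hgz x hx
    have hu' := hgmem u
    have hv' := hgmem v
    have hx' := hgmem x
    rw [Finset.mem_Icc] at hw hz hu' hv' hx'
    clear_value g d
    clear hd hdne hdw hg hgne hgw hgz hdmem hgmem hadj h hc
    omega
  have h13 : g 1 = g 3 := hpath 1 (by decide) 2 (by decide) 3 (by decide)
    (hgne 1 2 (by decide)) (hgne 2 3 (by decide))
  have h34 : g 3 = g 4 := hpath 3 (by decide) 5 (by decide) 4 (by decide)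
    (hgne 3 5 (by decide)) (hgne 5 4 (by decide))
  exact hgne 1 4 (by decide) (h13.trans h34)

/-- In every 4-colouring of `M'` each colour appears on one of `t_1, …, t_4`. -/
theorem exists_tvert_colour (f : Fin 23 → ℕ) (hf : ∀ i, f i ∈ Finset.Icc 1 4)
    (h : ∀ e ∈ MpEdges, f (vtx e.1) ≠ f (vtx e.2)) {a : ℕ} (ha : a ∈ Finset.Icc 1 4) :
    ∃ j ∈ Finset.Icc 1 4, f (tvert j) = a := by
  by_contra! hcon
  -- otherwise vertex 17 can be recoloured with `a`, giving a 4-colouring of `M_5`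
  have h2 : f (vtx 2) ≠ a := hcon 1 (by decide)
  have h4 : f (vtx 4) ≠ a := hcon 2 (by decide)
  have h11 : f (vtx 11) ≠ a := hcon 3 (by decide)
  have h23 : f (vtx 23) ≠ a := hcon 4 (by decide)
  refine not_proper_M5 (fun i => if i = 17 then a else f (vtx i)) ?_ ?_
  · intro i
    split_ifs
    · exact ha
    · exact hf _
  · intro e he
    have key : ∀ e ∈ M5Edges, e ∈ [(17, 23), (17, 2), (17, 4), (17, 11)] ∨
        e ∈ MpEdges ∧ e.1 ≠ 17 ∧ e.2 ≠ 17 := by decide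
    rcases key e he with he | ⟨he, h₁, h₂⟩
    · simp only [List.mem_cons, List.not_mem_nil, or_false] at he
      rcases he with rfl | rfl | rfl | rfl
      · simpa using h23.symm
      · simpa using h2.symm
      · simpa using h4.symm
      · simpa using h11.symm
    · simpa [h₁, h₂] using h e he

/-- A 4-colouring of `M'` in which `t_j` has colour `j`. -/
def MpColour : Fin 23 → ℕ :=
  ![3, 1, 2, 2, 1, 4, 1, 2, 2, 1, 3, 3, 1, 2, 2, 1, 4, 1, 2, 2, 1, 3, 4]

theorem MpColour_mem (t : Fin 23) : MpColour t ∈ Finset.Icc 1 4 := by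
  revert t; decide

theorem MpColour_proper : ∀ e ∈ MpEdges, MpColour (vtx e.1) ≠ MpColour (vtx e.2) := by
  decide

theorem MpColour_tvert : ∀ j ∈ Finset.Icc 1 4, MpColour (tvert j) = j := by
  decide

theorem cW4_b {n m : ℕ} (j : Fin m) (p : Bool) (h : Fin 2)
    (i : Fin (4 - (L'assign (.b j p h : JV' n m)).card)) :
    cW4 (.b j p h : JV' n m) i = i.val + 1 := by
  change Fin 2 at i
  change [1, 2].getD i.val 0 = i.val + 1
  fin_cases i <;> rfl

theorem cW4_c {n m : ℕ} (j : Fin m) (p : Bool) (h : Fin 3)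
    (i : Fin (4 - (L'assign (.c j p h : JV' n m)).card)) :
    cW4 (.c j p h : JV' n m) i = i.val + 3 := by
  change Fin 2 at i
  change [3, 4].getD i.val 0 = i.val + 3
  fin_cases i <;> rfl

theorem length_complList {n m : ℕ} (v : JV' n m) :
    (complList v).length = 4 - (L'assign v).card := by
  cases v with
  | a j p h => fin_cases p <;> fin_cases h <;> rfl
  | b j p h => rfl
  | x i => rfl
  | c j p h => rfl

theorem complList_subset {n m : ℕ} (v : JV' n m) :
    ∀ a ∈ complList v, a ∈ Finset.Icc 1 4 := by
  cases v with
  | a j p h => fin_cases p <;> fin_cases h <;> simp [complList]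
  | b j p h => simp [complList]
  | x i => simp [complList]
  | c j p h => simp [complList]

theorem cW4_mem {n m : ℕ} (v : JV' n m) (i : Fin (4 - (L'assign v).card)) :
    cW4 v i ∈ Finset.Icc 1 4 := by
  have hi : i.val < (complList v).length := by
    rw [length_complList]
    exact i.isLt
  rw [cW4, List.getD_eq_getElem _ _ hi]
  exact complList_subset v _ (List.getElem_mem hi)

theorem exists_extension_of_JStar_colouring {n m : ℕ} (I : NAE n m) (c : JStarV n m → ℕ)
    (hc : ∀ u v, (JStar I).Adj u v → c u ≠ c v) (hmem : ∀ u, c u ∈ Finset.Icc 1 4) :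
    ∃ c : JVK n m 4 → ℕ,
      (∀ u v, (JKGraph I 4).Adj u v → c u ≠ c v) ∧
      (∀ u, c u ∈ Finset.Icc 1 4) ∧
      (∀ v i, c (.pend v i) = cW4 v i) := by
  have hrel : ∀ {u v}, u ≠ v → JStarRel I u v → c u ≠ c v := fun hne hr =>
    hc _ _ ((fromRel_adj _ _ _).2 ⟨hne, Or.inl hr⟩)
  have hMp : ∀ e ∈ MpEdges, c (.mv (vtx e.1)) ≠ c (.mv (vtx e.2)) := by
    intro e he
    have hloop : ∀ e ∈ MpEdges, vtx e.1 ≠ vtx e.2 := by decide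
    exact hrel (fun h => hloop e he (JStarV.mv.inj h)) ⟨e, he, rfl, rfl⟩
  -- rename the colours so that `t_j` gets colour `j`
  have hex : ∀ u, ∃ j ∈ Finset.Icc 1 4, c (.mv (tvert j)) = c u := fun u =>
    exists_tvert_colour (fun t => c (.mv t)) (fun t => hmem _) hMp (hmem u)
  choose d hd hdc using hex
  have hdne : ∀ {u v}, c u ≠ c v → d u ≠ d v := by
    intro u v huv h
    exact huv (by rw [← hdc u, ← hdc v, h])
  have hdt : ∀ {u j}, c u ≠ c (.mv (tvert j)) → d u ≠ j := by
    rintro u _ h rfl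
    exact h (hdc u).symm
  have hpend : ∀ v i hv, d (.pend v i hv) = cW4 v i := by
    intro v i hv
    by_contra h
    exact hdt (u := .pend v i hv) (hrel (by simp) ⟨_, hd (.pend v i hv), h, rfl⟩) rfl
  refine ⟨fun u => match u with
    | .orig v => d (.orig v)
    | .pend v i => cW4 v i, fromRel_ne_of_rel ?_, ?_, fun _ _ => rfl⟩
  · rintro (u | ⟨u, i⟩) (v | ⟨v, k⟩) hne hr
    · exact hdne (hrel (fun h => hne (congrArg _ (JStarV.orig.inj h))) hr)
    · exact hr.elim
    · obtain rfl : u = v := Eq.symm hr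
      change cW4 u i ≠ d (.orig u)
      cases hu : u.isAX with
      | true =>
        rw [← hpend u i hu]
        exact hdne (hrel (by simp) rfl)
      | false =>
        cases u with
        | a => cases hu
        | x => cases hu
        | b j p h =>
          have h1 : d (.orig (.b j p h)) ≠ 1 :=
            hdt (hrel (by simp) (Or.inl ⟨rfl, Or.inl rfl⟩))
          have h2 : d (.orig (.b j p h)) ≠ 2 :=
            hdt (hrel (by simp) (Or.inl ⟨rfl, Or.inr rfl⟩))
          have hi : i.val < 2 := i.isLt
          rw [cW4_b]
          omega
        | c j p h =>
          have h3 : d (.orig (.c j p h)) ≠ 3 :=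
            hdt (hrel (by simp) (Or.inr ⟨rfl, Or.inl rfl⟩))
          have h4 : d (.orig (.c j p h)) ≠ 4 :=
            hdt (hrel (by simp) (Or.inr ⟨rfl, Or.inr rfl⟩))
          have hi : i.val < 2 := i.isLt
          rw [cW4_c]
          omega
    · exact hr.elim
  · rintro (u | ⟨u, i⟩)
    · exact hd _
    · exact cW4_mem u i

theorem exists_JStar_colouring_of_extension {n m : ℕ} (I : NAE n m) (c : JVK n m 4 → ℕ)
    (hc : ∀ u v, (JKGraph I 4).Adj u v → c u ≠ c v) (hmem : ∀ u, c u ∈ Finset.Icc 1 4)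
    (hpre : ∀ v i, c (.pend v i) = cW4 v i) :
    ∃ c : JStarV n m → ℕ,
      (∀ u v, (JStar I).Adj u v → c u ≠ c v) ∧ ∀ u, c u ∈ Finset.Icc 1 4 := by
  have hrel : ∀ {u v}, u ≠ v → JKRel I u v → c u ≠ c v := fun hne hr =>
    hc _ _ ((fromRel_adj _ _ _).2 ⟨hne, Or.inl hr⟩)
  have hpend : ∀ v i, cW4 v i ≠ c (.orig v) := by
    intro v i
    rw [← hpre]
    exact hrel (by simp) rfl
  refine ⟨fun u => match u with
    | .orig v => c (.orig v)
    | .pend v i _ => cW4 v i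
    | .mv t => MpColour t, fromRel_ne_of_rel ?_, ?_⟩
  · rintro (u | ⟨u, i, hu⟩ | s) (v | ⟨v, k, hv⟩ | t) hne hr
    · exact hrel (fun h => hne (congrArg _ (JVK.orig.inj h))) hr
    · exact hr.elim
    · change c (.orig u) ≠ MpColour t
      rcases hr with ⟨hu, ht⟩ | ⟨hu, ht⟩
      · cases u with
        | b j p h =>
          rcases ht with rfl | rfl
          · exact (hpend (.b j p h) (0 : Fin 2)).symm
          · exact (hpend (.b j p h) (1 : Fin 2)).symm
        | _ => cases hu
      · cases u with
        | c j p h =>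
          rcases ht with rfl | rfl
          · exact (hpend (.c j p h) (0 : Fin 2)).symm
          · exact (hpend (.c j p h) (1 : Fin 2)).symm
        | _ => cases hu
    · obtain rfl : u = v := Eq.symm hr
      exact hpend u i
    · exact hr.elim
    · obtain ⟨j, hj, hne', rfl⟩ := hr
      change cW4 u i ≠ MpColour (tvert j)
      rw [MpColour_tvert j hj]
      exact hne'.symm
    · exact hr.elim
    · exact hr.elim
    · obtain ⟨e, he, rfl, rfl⟩ := hr
      exact MpColour_proper e he
  · rintro (u | ⟨u, i, hu⟩ | t)
    · exact hmem _
    · exact cW4_mem u i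
    · exact MpColour_mem t

/- Statement 16 -/
theorem stmt16 {n m : ℕ} (I : NAE n m) :
    (∃ c : JStarV n m → ℕ,
        (∀ u v, (JStar I).Adj u v → c u ≠ c v) ∧ ∀ u, c u ∈ Finset.Icc 1 4) ↔
    (∃ c : JVK n m 4 → ℕ,
        (∀ u v, (JKGraph I 4).Adj u v → c u ≠ c v) ∧
        (∀ u, c u ∈ Finset.Icc 1 4) ∧
        (∀ v i, c (.pend v i) = cW4 v i)) := by
  constructor
  · rintro ⟨c, hc, hmem⟩
    exact exists_extension_of_JStar_colouring I c hc hmem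
  · rintro ⟨c, hc, hmem, hpre⟩
    exact exists_JStar_colouring_of_extension I c hc hmem hpre
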